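/- Let μ be a Borel probability measure on ℝ with cdf F(y) = μ((-∞, y]), let τ ∈ [0,1], and let a ≤ b be real numbers. Then ∫ (ρ_τ(y − b) − ρ_τ(y − a)) dμ(y) = ∫_a^b (F(s) − τ) ds; in particular the integrand on the left is μ-integrable. -/

import Mathlib

open MeasureTheory

/-- The cumulative distribution function of a Borel measure on `ℝ`. -/
noncomputable def cdfOf (μ : Measure ℝ) (y : ℝ) : ℝ := (μ (Set.Iic y)).toReal

/-- The Koenker–Bassett check function `ρ_τ(u) = u (τ − 1{u < 0})`. -/
noncomputable def checkFun (τ u : ℝ) : ℝ := u * (τ - if u < 0 then 1 else 0)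

/-- The cdf as the expectation of the indicator `1{y ≤ s}`, shifted by a constant. -/
lemma cdfOf_sub_eq_integral (μ : Measure ℝ) [IsProbabilityMeasure μ] (τ s : ℝ) :
    cdfOf μ s - τ = ∫ y, ((Set.Iic s).indicator 1 y - τ) ∂μ := by
  have hint : Integrable ((Set.Iic s).indicator (1 : ℝ → ℝ)) μ :=
    (integrable_const 1).indicator measurableSet_Iic
  rw [integral_sub hint (integrable_const τ), integral_indicator_one measurableSet_Iic]
  simp [cdfOf, Measure.real]

lemma indicator_Iic_eq_indicator_Ici (y : ℝ) :
    (fun s => (Set.Iic s).indicator (1 : ℝ → ℝ) y) = (Set.Ici y).indicator 1 := by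
  ext s
  simp [Set.indicator_apply]

lemma setIntegral_indicator_Iic {a b : ℝ} (hab : a ≤ b) (y : ℝ) :
    ∫ s in Set.Ioc a b, (Set.Iic s).indicator (1 : ℝ → ℝ) y = max (b - y) 0 - max (a - y) 0 := by
  rw [indicator_Iic_eq_indicator_Ici, integral_indicator_one measurableSet_Ici,
    measureReal_restrict_apply measurableSet_Ici]
  rcases le_or_gt y a with hya | hay
  · rw [Set.inter_eq_right.2 (Set.Ioc_subset_Ioi_self.trans (Set.Ioi_subset_Ici hya)),
      Real.volume_real_Ioc_of_le hab, max_eq_left (by linarith), max_eq_left (by linarith)]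
    ring
  · have hset : Set.Ici y ∩ Set.Ioc a b = Set.Icc y b := by
      ext s
      simp only [Set.mem_inter_iff, Set.mem_Ici, Set.mem_Ioc, Set.mem_Icc]
      exact ⟨fun hs => ⟨hs.1, hs.2.2⟩, fun hs => ⟨hs.1, hay.trans_le hs.1, hs.2⟩⟩
    rw [hset, Real.volume_real_Icc, max_eq_right (a := a - y) (by linarith), sub_zero]

/-- Knight's identity for the check function. -/
lemma checkFun_sub_eq_setIntegral (τ : ℝ) {a b : ℝ} (hab : a ≤ b) (y : ℝ) :
    checkFun τ (y - b) - checkFun τ (y - a) =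
      ∫ s in Set.Ioc a b, ((Set.Iic s).indicator (1 : ℝ → ℝ) y - τ) := by
  have hint : IntegrableOn (fun s => (Set.Iic s).indicator (1 : ℝ → ℝ) y) (Set.Ioc a b) := by
    rw [indicator_Iic_eq_indicator_Ici]
    exact (integrable_const 1).indicator measurableSet_Ici
  rw [integral_sub hint (integrable_const τ), setIntegral_indicator_Iic hab, setIntegral_const,
    Real.volume_real_Ioc_of_le hab, smul_eq_mul]
  unfold checkFun
  rcases lt_or_ge (y - b) 0 with h1 | h1 <;> rcases lt_or_ge (y - a) 0 with h2 | h2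
  · rw [if_pos h1, if_pos h2, max_eq_left (by linarith), max_eq_left (by linarith)]
    ring
  · rw [if_pos h1, if_neg h2.not_gt, max_eq_left (by linarith), max_eq_right (by linarith)]
    ring
  · linarith
  · rw [if_neg h1.not_gt, if_neg h2.not_gt, max_eq_right (by linarith),
      max_eq_right (by linarith)]
    ring

lemma integrable_prod_indicator_Iic_sub (μ ν : Measure ℝ) [IsFiniteMeasure μ]
    [IsFiniteMeasure ν] (τ : ℝ) :
    Integrable (Function.uncurry fun y s : ℝ => (Set.Iic s).indicator (1 : ℝ → ℝ) y - τ)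
      (μ.prod ν) := by
  have h : (Function.uncurry fun y s : ℝ => (Set.Iic s).indicator (1 : ℝ → ℝ) y - τ) =
      fun p => {p : ℝ × ℝ | p.1 ≤ p.2}.indicator 1 p - τ := by
    ext ⟨y, s⟩
    simp [Set.indicator_apply]
  rw [h]
  exact ((integrable_const 1).indicator
    (measurableSet_le measurable_fst measurable_snd)).sub (integrable_const τ)

/-- For `τ ∈ [0,1]` and `a ≤ b`, the change in expected check loss satisfies
`∫ (ρ_τ(y − b) − ρ_τ(y − a)) dμ(y) = ∫_a^b (F s − τ) ds`; in particular the
integrand on the left is `μ`-integrable. -/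
theorem integral_checkFun_sub_eq (μ : Measure ℝ) [IsProbabilityMeasure μ]
    (τ : ℝ) (hτ : τ ∈ Set.Icc (0 : ℝ) 1) (a b : ℝ) (hab : a ≤ b) :
    Integrable (fun y : ℝ => checkFun τ (y - b) - checkFun τ (y - a)) μ ∧
    ∫ y, (checkFun τ (y - b) - checkFun τ (y - a)) ∂μ = ∫ s in a..b, (cdfOf μ s - τ) := by
  have hprod := integrable_prod_indicator_Iic_sub μ (volume.restrict (Set.Ioc a b)) τ
  simp_rw [checkFun_sub_eq_setIntegral τ hab, cdfOf_sub_eq_integral,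
    intervalIntegral.integral_of_le hab]
  exact ⟨hprod.integral_prod_left, integral_integral_swap hprod⟩
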